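/- Every nonzero element x of F_ℝ of a given rank is SL(2,ℝ)-related to a canonical form as follows: if x ≠ 0 and Υ(x, y) = 0 for all y (rank 1), then x is SL(2,ℝ)-related to (1, 0, 0, 0); if Δ(x) = 0 and T(x) ≠ 0 (rank 3), then x is SL(2,ℝ)-related to (0, 0, 1, 0); and if Δ(x) ≠ 0 (rank 4), then there exists k > 0 such that x is SL(2,ℝ)-related to (k, 0, −k, 0) or (k, 0, k, 0). (There are no rank-2 elements in F_ℝ.) -/

import Mathlib

open Real

/-- The Freudenthal triple system `F_ℝ = ℝ⁴`, with elements `x = (α, β, A, B)`. -/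
abbrev FR : Type := ℝ × ℝ × ℝ × ℝ

/-- The antisymmetric bilinear form `{x, y} = αδ - βγ + 3(AD - BC)`. -/
noncomputable def sympR (x y : FR) : ℝ :=
  x.1 * y.2.1 - x.2.1 * y.1 + 3 * (x.2.2.1 * y.2.2.2 - x.2.2.2 * y.2.2.1)

/-- The quartic form `Δ(x) = -(αβ - 3AB)² - 4(α A³ + β B³ - 3A²B²)`. -/
noncomputable def DltR (x : FR) : ℝ :=
  -(x.1 * x.2.1 - 3 * x.2.2.1 * x.2.2.2) ^ 2
    - 4 * (x.1 * x.2.2.1 ^ 3 + x.2.1 * x.2.2.2 ^ 3 - 3 * x.2.2.1 ^ 2 * x.2.2.2 ^ 2)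

/-- The binary cubic form `p_x(u, v) = α u³ + 3B u²v + 3A uv² + β v³` attached to
`x = (α, β, A, B) ∈ F_ℝ`. -/
noncomputable def cub (x : FR) (u v : ℝ) : ℝ :=
  x.1 * u ^ 3 + 3 * x.2.2.2 * u ^ 2 * v + 3 * x.2.2.1 * u * v ^ 2 + x.2.1 * v ^ 3

/-- `SL(2,ℝ)`-relatedness: `y = M·x` for some `M = [[a,b],[c,d]] ∈ SL(2,ℝ)`, i.e.
`p_y(u, v) = p_x(au + cv, bu + dv)` for all `u, v`. -/
def SLRel (x y : FR) : Prop :=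
  ∃ a b c d : ℝ, a * d - b * c = 1 ∧
    ∀ u v : ℝ, cub y u v = cub x (a * u + c * v) (b * u + d * v)

/-- `T` is the triple-product map: `{T(x), z} = ½ (d/ds)|₀ Δ(x + s z)` for all `x, z`. -/
def IsTripleMapR (T : FR → FR) : Prop :=
  ∀ x z, sympR (T x) z = (1 / 2) * deriv (fun s : ℝ => DltR (x + s • z)) 0

/-- `Υ(x, y) = (d/ds)|₀ T(x + s y) + {x, y} x`. -/
noncomputable def UpsR (T : FR → FR) (x y : FR) : FR :=
  deriv (fun s : ℝ => T (x + s • y)) 0 + sympR x y • x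

/-- The element whose cubic form is `p_x(au + cv, bu + dv)`. -/
noncomputable def substFR (a b c d : ℝ) (x : FR) : FR :=
  (cub x a b, cub x c d,
    x.1 * a * c ^ 2 + x.2.2.2 * (2 * a * c * d + b * c ^ 2)
      + x.2.2.1 * (a * d ^ 2 + 2 * b * c * d) + x.2.1 * b * d ^ 2,
    x.1 * a ^ 2 * c + x.2.2.2 * (2 * a * b * c + a ^ 2 * d)
      + x.2.2.1 * (b ^ 2 * c + 2 * a * b * d) + x.2.1 * b ^ 2 * d)

lemma cub_substFR (a b c d : ℝ) (x : FR) (u v : ℝ) :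
    cub (substFR a b c d x) u v = cub x (a * u + c * v) (b * u + d * v) := by
  simp only [cub, substFR]
  ring

lemma cub_injective {x y : FR} (h : ∀ u v, cub x u v = cub y u v) : x = y := by
  have h1 := h 1 0
  have h2 := h 0 1
  have h3 := h 1 1
  have h4 := h 1 (-1)
  obtain ⟨α, β, A, B⟩ := x
  obtain ⟨γ, δ, C, D⟩ := y
  simp only [cub] at h1 h2 h3 h4
  simp only [Prod.mk.injEq]
  refine ⟨?_, ?_, ?_, ?_⟩ <;> linarith

lemma SLRel_iff_substFR {x y : FR} :
    SLRel x y ↔ ∃ a b c d : ℝ, a * d - b * c = 1 ∧ y = substFR a b c d x := by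
  constructor
  · rintro ⟨a, b, c, d, h, hy⟩
    exact ⟨a, b, c, d, h, cub_injective fun u v => by rw [hy, cub_substFR]⟩
  · rintro ⟨a, b, c, d, h, rfl⟩
    exact ⟨a, b, c, d, h, cub_substFR a b c d x⟩

lemma SLRel.trans {x y z : FR} (hxy : SLRel x y) (hyz : SLRel y z) : SLRel x z := by
  obtain ⟨a, b, c, d, h, hy⟩ := hxy
  obtain ⟨a', b', c', d', h', hz⟩ := hyz
  refine ⟨a * a' + c * b', b * a' + d * b', a * c' + c * d', b * c' + d * d', ?_, ?_⟩
  · linear_combination (a' * d' - b' * c') * h + h'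
  · intro u v
    rw [hz, hy]
    congr 1 <;> ring

lemma SLRel.symm {x y : FR} (hxy : SLRel x y) : SLRel y x := by
  obtain ⟨a, b, c, d, h, hy⟩ := hxy
  refine ⟨d, -b, -c, a, by linear_combination h, fun u v => ?_⟩
  rw [hy]
  congr 1
  · linear_combination (-u) * h
  · linear_combination (-v) * h

lemma DltR_substFR (a b c d : ℝ) (x : FR) :
    DltR (substFR a b c d x) = (a * d - b * c) ^ 6 * DltR x := by
  simp only [DltR, substFR, cub]
  ring

lemma SLRel.DltR_eq {x y : FR} (h : SLRel x y) : DltR y = DltR x := by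
  obtain ⟨a, b, c, d, hdet, rfl⟩ := SLRel_iff_substFR.1 h
  rw [DltR_substFR, hdet, one_pow, one_mul]

/-- A real binary cubic form has a real linear factor, which can be moved to `u`. -/
lemma exists_SLRel_snd_eq_zero (x : FR) : ∃ α A B : ℝ, SLRel x (α, 0, A, B) := by
  obtain ⟨θ, hθ⟩ : ∃ θ : ℝ, cub x (cos θ) (sin θ) = 0 := by
    have hc : Continuous fun θ : ℝ => cub x (cos θ) (sin θ) := by
      unfold cub
      fun_prop
    have hπ : cub x (cos π) (sin π) = -cub x (cos 0) (sin 0) := by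
      simp [cub]
      ring
    rcases le_total (cub x (cos 0) (sin 0)) 0 with h | h
    · exact mem_range_of_exists_le_of_exists_ge hc ⟨0, h⟩ ⟨π, by linarith⟩
    · exact mem_range_of_exists_le_of_exists_ge hc ⟨π, by linarith⟩ ⟨0, h⟩
  have h : SLRel x (substFR (sin θ) (-cos θ) (cos θ) (sin θ) x) :=
    SLRel_iff_substFR.2 ⟨_, _, _, _, by linear_combination sin_sq_add_cos_sq θ, rfl⟩
  rw [substFR, hθ] at h
  exact ⟨_, _, _, h⟩

/-- Completing the square in `u(αu² + 3Buv + 3Av²)`. -/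
lemma SLRel_complete_square (α A B : ℝ) (hA : A ≠ 0) :
    SLRel (α, 0, A, B) (α - 3 * B ^ 2 / (4 * A), 0, A, 0) := by
  refine ⟨1, -B / (2 * A), 0, 1, by ring, fun u v => ?_⟩
  simp only [cub]
  field_simp
  ring

lemma SLRel_diag (α A t : ℝ) (ht : t ≠ 0) :
    SLRel (α, 0, A, 0) (α * t ^ 3, 0, A / t, 0) := by
  refine ⟨t, 0, 0, t⁻¹, by simp [ht], fun u v => ?_⟩
  simp only [cub]
  field_simp
  ring

/-- The explicit form of the triple-product map. -/
noncomputable def tripleR (x : FR) : FR :=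
  (-x.1 ^ 2 * x.2.1 + 3 * x.1 * x.2.2.1 * x.2.2.2 - 2 * x.2.2.2 ^ 3,
    x.1 * x.2.1 ^ 2 - 3 * x.2.1 * x.2.2.1 * x.2.2.2 + 2 * x.2.2.1 ^ 3,
    x.1 * x.2.1 * x.2.2.1 + x.2.2.1 ^ 2 * x.2.2.2 - 2 * x.2.1 * x.2.2.2 ^ 2,
    -x.1 * x.2.1 * x.2.2.2 - x.2.2.1 * x.2.2.2 ^ 2 + 2 * x.1 * x.2.2.1 ^ 2)

lemma hasDerivAt_line (p q : ℝ) : HasDerivAt (fun s : ℝ => p + s * q) q 0 := by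
  simpa using ((hasDerivAt_id (0 : ℝ)).mul_const q).const_add p

lemma deriv_DltR_line (x z : FR) :
    deriv (fun s : ℝ => DltR (x + s • z)) 0 = 2 * sympR (tripleR x) z := by
  obtain ⟨α, β, A, B⟩ := x
  obtain ⟨γ, δ, C, D⟩ := z
  have ha := hasDerivAt_line α γ
  have hb := hasDerivAt_line β δ
  have hA := hasDerivAt_line A C
  have hB := hasDerivAt_line B D
  have h := (((ha.mul hb).sub ((hA.const_mul 3).mul hB)).pow 2).neg.sub
    ((((ha.mul (hA.pow 3)).add (hb.mul (hB.pow 3))).sub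
      (((hA.pow 2).const_mul 3).mul (hB.pow 2))).const_mul 4)
  refine Eq.trans (h.congr_deriv ?_).deriv rfl
  simp only [sympR, tripleR, Pi.mul_apply, Pi.sub_apply, Pi.pow_apply]
  norm_num
  ring

lemma IsTripleMapR.eq_tripleR {T : FR → FR} (hT : IsTripleMapR T) : T = tripleR := by
  funext x
  have h : ∀ z, sympR (T x) z = sympR (tripleR x) z := fun z => by
    rw [hT, deriv_DltR_line]
    ring
  have h1 := h (1, 0, 0, 0)
  have h2 := h (0, 1, 0, 0)
  have h3 := h (0, 0, 1, 0)
  have h4 := h (0, 0, 0, 1)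
  generalize T x = y at *
  generalize tripleR x = w at *
  obtain ⟨y1, y2, y3, y4⟩ := y
  obtain ⟨w1, w2, w3, w4⟩ := w
  simp only [sympR] at h1 h2 h3 h4
  simp only [Prod.mk.injEq]
  refine ⟨?_, ?_, ?_, ?_⟩ <;> linarith

lemma differentiable_tripleR : Differentiable ℝ tripleR := by
  unfold tripleR
  fun_prop

/-- Vanishing of `Υ(x, ·)` forces the Hessian of the cubic form to vanish. -/
lemma hessian_eq_zero_of_UpsR_eq_zero {α β A B : ℝ}
    (h : ∀ y, UpsR tripleR (α, β, A, B) y = 0) :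
    α * A = B ^ 2 ∧ α * β = A * B ∧ β * B = A ^ 2 := by
  have hd (y : FR) : HasDerivAt (fun s : ℝ => tripleR ((α, β, A, B) + s • y))
      (-sympR (α, β, A, B) y • ((α, β, A, B) : FR)) 0 := by
    have hdiff : DifferentiableAt ℝ (fun s : ℝ => tripleR ((α, β, A, B) + s • y)) 0 :=
      (differentiable_tripleR _).comp (0 : ℝ) (by fun_prop)
    have h0 := hdiff.hasDerivAt
    rwa [eq_neg_of_add_eq_zero_left (h y), ← neg_smul] at h0
  have hfst (y : FR) := (hd y).fst
  have hsnd (y : FR) := (hd y).snd.fst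
  have key (γ δ C D : ℝ) := by
    have ha := hasDerivAt_line α γ
    have hb := hasDerivAt_line β δ
    have hA := hasDerivAt_line A C
    have hB := hasDerivAt_line B D
    have e1 := (((((ha.pow 2).neg).mul hb).add (((ha.const_mul 3).mul hA).mul hB)).sub
      ((hB.pow 3).const_mul 2))
    have e2 := (((ha.mul (hb.pow 2)).sub (((hb.const_mul 3).mul hA).mul hB)).add
      ((hA.pow 3).const_mul 2))
    exact And.intro (e1.unique (hfst (γ, δ, C, D))) (e2.unique (hsnd (γ, δ, C, D)))
  have k1 := (key 1 0 0 0).1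
  have k2 := (key 0 0 0 1).1
  have k3 := (key 0 0 1 0).2
  simp [sympR] at k1 k2 k3
  refine ⟨?_, ?_, ?_⟩ <;> linarith

lemma exists_cube_eq (r : ℝ) : ∃ t : ℝ, t ^ 3 = r := by
  have h : (|r| ^ ((3 : ℕ) : ℝ)⁻¹) ^ 3 = |r| := rpow_inv_natCast_pow (abs_nonneg r) (by norm_num)
  rcases abs_choice r with hr | hr
  · exact ⟨_, h.trans hr⟩
  · exact ⟨-|r| ^ ((3 : ℕ) : ℝ)⁻¹, by rw [Odd.neg_pow (by decide), h, hr, neg_neg]⟩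

lemma SLRel_of_hessian_eq_zero {α β A B : ℝ} (hx : ((α, β, A, B) : FR) ≠ 0)
    (h1 : α * A = B ^ 2) (h2 : α * β = A * B) (h3 : β * B = A ^ 2) :
    SLRel (α, β, A, B) (1, 0, 0, 0) := by
  by_cases hα : α = 0
  · subst hα
    have hB : B = 0 := by simpa using h1.symm
    subst hB
    have hA : A = 0 := by simpa using h3.symm
    subst hA
    obtain ⟨t, rfl⟩ := exists_cube_eq β
    have ht : t ≠ 0 := by
      rintro rfl
      simp at hx
    refine ⟨0, t⁻¹, -t, 0, by simp [ht], fun u v => ?_⟩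
    simp only [cub]
    field_simp
    ring
  · have hA : A = B ^ 2 / α := by
      field_simp
      linarith
    have hβ : β = A * B / α := by
      field_simp
      linarith
    subst hβ
    subst hA
    obtain ⟨t, rfl⟩ := exists_cube_eq α
    have ht : t ≠ 0 := by
      rintro rfl
      simp at hα
    refine ⟨t⁻¹, 0, -B / t ^ 2, t, by simp [ht], fun u v => ?_⟩
    simp only [cub]
    field_simp
    ring

lemma tripleR_eq_zero_of_SLRel {x : FR} {α : ℝ} (h : SLRel x (α, 0, 0, 0)) :
    tripleR x = 0 := by
  obtain ⟨a, b, c, d, -, rfl⟩ := SLRel_iff_substFR.1 h.symm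
  simp only [tripleR, substFR, cub, Prod.mk_eq_zero]
  refine ⟨?_, ?_, ?_, ?_⟩ <;> ring

lemma SLRel_of_DltR_eq_zero {x : FR} (hΔ : DltR x = 0) (hT : tripleR x ≠ 0) :
    SLRel x (0, 0, 1, 0) := by
  obtain ⟨α, A, B, h⟩ := exists_SLRel_snd_eq_zero x
  by_cases hA : A = 0
  · subst hA
    have hB : B ≠ 0 := by
      rintro rfl
      exact hT (tripleR_eq_zero_of_SLRel h)
    refine h.trans ⟨0, B, -1 / B, α / (3 * B ^ 2), by field_simp; ring, fun u v => ?_⟩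
    simp only [cub]
    field_simp
    ring
  · have h' := h.trans (SLRel_complete_square α A B hA)
    have hα : α - 3 * B ^ 2 / (4 * A) = 0 := by
      have hz := h'.DltR_eq.trans hΔ
      simp only [DltR] at hz
      have : (α - 3 * B ^ 2 / (4 * A)) * A ^ 3 = 0 := by linarith
      simpa [hA] using this
    rw [hα] at h'
    simpa [hA] using h'.trans (SLRel_diag 0 A A hA)

lemma SLRel_of_DltR_ne_zero {x : FR} (hΔ : DltR x ≠ 0) :
    ∃ k : ℝ, 0 < k ∧ (SLRel x (k, 0, -k, 0) ∨ SLRel x (k, 0, k, 0)) := by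
  obtain ⟨α₀, A, B, h⟩ := exists_SLRel_snd_eq_zero x
  have hA : A ≠ 0 := by
    rintro rfl
    exact hΔ (by rw [← h.DltR_eq]; simp [DltR])
  replace h := h.trans (SLRel_complete_square α₀ A B hA)
  generalize α₀ - 3 * B ^ 2 / (4 * A) = α at h
  have hα : α ≠ 0 := by
    rintro rfl
    exact hΔ (by rw [← h.DltR_eq]; simp [DltR])
  obtain ⟨s, hs0, hs⟩ : ∃ s : ℝ, 0 < s ∧ s ^ 4 = |A / α| :=
    ⟨|A / α| ^ ((4 : ℕ) : ℝ)⁻¹, by positivity, rpow_inv_natCast_pow (abs_nonneg _) (by norm_num)⟩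
  obtain ⟨t, ht, hk⟩ : ∃ t : ℝ, t ^ 4 = |A / α| ∧ 0 < α * t ^ 3 := by
    rcases hα.lt_or_gt with hneg | hpos
    · refine ⟨-s, by rw [← hs]; ring, ?_⟩
      have := mul_pos (neg_pos.2 hneg) (pow_pos hs0 3)
      linarith
    · exact ⟨s, hs, by positivity⟩
  have ht0 : t ≠ 0 := by
    rintro rfl
    simp at hk
  have h' := h.trans (SLRel_diag α A t ht0)
  refine ⟨α * t ^ 3, hk, ?_⟩
  rcases abs_choice (A / α) with ha | ha
  · right
    have : A / t = α * t ^ 3 := by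
      rw [ha] at ht
      field_simp at ht ⊢
      linarith
    rwa [this] at h'
  · left
    have : A / t = -(α * t ^ 3) := by
      rw [ha] at ht
      field_simp at ht ⊢
      linarith
    rwa [this] at h'

/-- classification of the `SL(2,ℝ)`-orbits of `F_ℝ` by rank: rank-1
elements (`x ≠ 0`, `Υ(x,·) ≡ 0`) are related to `(1,0,0,0)`; rank-3 elements (`Δ(x) = 0`,
`T(x) ≠ 0`) to `(0,0,1,0)`; rank-4 elements (`Δ(x) ≠ 0`) to `(k,0,-k,0)` or `(k,0,k,0)`
for some `k > 0`. (There are no rank-2 elements in `F_ℝ`.) -/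
theorem fr_orbit_classification (T : FR → FR) (hT : IsTripleMapR T) (x : FR) :
    ((x ≠ 0 ∧ ∀ y, UpsR T x y = 0) → SLRel x (1, 0, 0, 0)) ∧
    ((DltR x = 0 ∧ T x ≠ 0) → SLRel x (0, 0, 1, 0)) ∧
    (DltR x ≠ 0 → ∃ k : ℝ, 0 < k ∧
      (SLRel x (k, 0, -k, 0) ∨ SLRel x (k, 0, k, 0))) := by
  obtain rfl := hT.eq_tripleR
  refine ⟨fun ⟨hx, h⟩ => ?_, fun ⟨hΔ, hTx⟩ => SLRel_of_DltR_eq_zero hΔ hTx,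
    SLRel_of_DltR_ne_zero⟩
  obtain ⟨α, β, A, B⟩ := x
  obtain ⟨h1, h2, h3⟩ := hessian_eq_zero_of_UpsR_eq_zero h
  exact SLRel_of_hessian_eq_zero hx h1 h2 h3
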